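/- For every n ≥ 1 and m ≥ 0, the number of Schröder paths of semilength n with exactly n−m diagonal steps, in which every diagonal step is immediately followed by a horizontal step except if it is the last step of the path, equals C(m)·binom(m+1, n−m), where C(m) is the m-th Catalan number. -/

import Mathlib

/-! Schröder paths -/

inductive SStep : Type
  | H | V | D
deriving DecidableEq

def SStep.dx : SStep → ℕ
  | .H => 1 | .V => 0 | .D => 1

def SStep.dy : SStep → ℕ
  | .H => 0 | .V => 1 | .D => 1

def pathX (p : List SStep) : ℕ := (p.map SStep.dx).sum
def pathY (p : List SStep) : ℕ := (p.map SStep.dy).sum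

/-- A Schröder path of semilength `n`: from (0,0) to (n,n), steps H,V,D,
never rising above the diagonal. -/
def IsSchroder (n : ℕ) (p : List SStep) : Prop :=
  pathX p = n ∧ pathY p = n ∧ ∀ q : List SStep, q <+: p → pathY q ≤ pathX q

/-- No diagonal step starts on the diagonal. -/
def DiagFree (p : List SStep) : Prop :=
  ∀ q r : List SStep, p = q ++ SStep.D :: r → pathX q ≠ pathY q

/-- Every diagonal step is immediately followed by a horizontal step,
except if it is the last step. -/
def DFollowedByH (p : List SStep) : Prop :=
  ∀ q r : List SStep, p = q ++ SStep.D :: r → r = [] ∨ ∃ r' : List SStep, r = SStep.H :: r'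

def SP (n m : ℕ) : Type := {p : List SStep // IsSchroder n p ∧ p.count SStep.D + m = n}
def SPplus (n m : ℕ) : Type :=
  {p : List SStep // IsSchroder n p ∧ p.count SStep.D + m = n ∧ DiagFree p}
def SPzero (n m : ℕ) : Type :=
  {p : List SStep // IsSchroder n p ∧ p.count SStep.D + m = n ∧ ¬ DiagFree p}
def RP (n m : ℕ) : Type :=
  {p : List SStep // IsSchroder n p ∧ p.count SStep.D + m = n ∧ DFollowedByH p}

/-! Rooted planar trees -/

inductive PTree : Type
  | node : List PTree → PTree

namespace PTree

def leaves : PTree → ℕ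
  | node [] => 1
  | node (c :: cs) => ((c :: cs).attach.map fun x => leaves x.1).sum
decreasing_by
  have := List.sizeOf_lt_of_mem x.2
  simp only [PTree.node.sizeOf_spec, List.cons.sizeOf_spec] at this ⊢
  omega

def internal : PTree → ℕ
  | node [] => 0
  | node (c :: cs) => 1 + ((c :: cs).attach.map fun x => internal x.1).sum
decreasing_by
  have := List.sizeOf_lt_of_mem x.2
  simp only [PTree.node.sizeOf_spec, List.cons.sizeOf_spec] at this ⊢
  omega

def Good : PTree → Prop
  | node cs => cs.length ≠ 1 ∧ ∀ c ∈ cs.attach, Good c.1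
decreasing_by
  have := List.sizeOf_lt_of_mem c.2
  simp only [PTree.node.sizeOf_spec] at this ⊢
  omega

end PTree

def PT (n m : ℕ) : Type :=
  {t : PTree // t.Good ∧ t.leaves = n + 1 ∧ t.internal = m}

def PTn (n : ℕ) : Type := {t : PTree // t.Good ∧ t.leaves = n + 1}

/-! Motzkin paths -/

inductive MStep : Type
  | U | H | D
deriving DecidableEq

def MStep.dh : MStep → ℤ
  | .U => 1 | .H => 0 | .D => -1

def mHeight (p : List MStep) : ℤ := (p.map MStep.dh).sum

def IsMotzkin (k : ℕ) (p : List MStep) : Prop :=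
  p.length = k ∧ mHeight p = 0 ∧ ∀ q : List MStep, q <+: p → 0 ≤ mHeight q

def HFollowedByU (p : List MStep) : Prop :=
  ∀ q r : List MStep, p = q ++ MStep.H :: r → r = [] ∨ ∃ r' : List MStep, r = MStep.U :: r'

def MP (k : ℕ) : Type := {p : List MStep // IsMotzkin k p}
def RMP (k : ℕ) : Type := {p : List MStep // IsMotzkin k p ∧ HFollowedByU p}

/-- Motzkin steps with two possible colors on up and horizontal steps. -/
inductive CMStep : Type
  | U : Bool → CMStep
  | H : Bool → CMStep
  | D : CMStep
deriving DecidableEq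

def CMStep.forget : CMStep → MStep
  | .U _ => .U | .H _ => .H | .D => .D

/-- (h,u)-colored Motzkin paths of length n-1. -/
def huMP (n : ℕ) : Type := {p : List CMStep // IsMotzkin (n - 1) (p.map CMStep.forget)}


/-- The Dyck step underlying a Schröder step, diagonal steps being discarded. -/
def SStep.toDyck : SStep → Option DyckStep
  | .H => some .U | .V => some .D | .D => none

/-- The Dyck steps left after erasing the diagonal steps of a path. -/
def eraseDiag (p : List SStep) : List DyckStep := p.filterMap SStep.toDyck

@[simp] lemma eraseDiag_nil : eraseDiag [] = [] := rfl
@[simp] lemma eraseDiag_cons_H (p : List SStep) :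
    eraseDiag (.H :: p) = .U :: eraseDiag p := rfl
@[simp] lemma eraseDiag_cons_V (p : List SStep) :
    eraseDiag (.V :: p) = .D :: eraseDiag p := rfl
@[simp] lemma eraseDiag_cons_D (p : List SStep) :
    eraseDiag (.D :: p) = eraseDiag p := rfl

lemma pathX_eq_count (p : List SStep) :
    pathX p = (eraseDiag p).count .U + p.count .D := by
  induction p with
  | nil => rfl
  | cons s p ih =>
    simp only [pathX] at ih
    cases s <;> simp [pathX, SStep.dx, ih] <;> omega

lemma pathY_eq_count (p : List SStep) :
    pathY p = (eraseDiag p).count .D + p.count .D := by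
  induction p with
  | nil => rfl
  | cons s p ih =>
    simp only [pathY] at ih
    cases s <;> simp [pathY, SStep.dy, ih] <;> omega

lemma pathY_le_pathX_of_prefix_iff (p : List SStep) :
    (∀ q, q <+: p → pathY q ≤ pathX q) ↔
      ∀ i, ((eraseDiag p).take i).count .D ≤ ((eraseDiag p).take i).count .U := by
  simp only [pathX_eq_count, pathY_eq_count, Nat.add_le_add_iff_right]
  constructor
  · intro h i
    obtain ⟨q, hq, e⟩ := List.prefix_filterMap_iff.1 (List.take_prefix i (eraseDiag p))
    rw [e]
    exact h q hq
  · intro h q hq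
    have hq' : eraseDiag q <+: eraseDiag p := hq.filterMap SStep.toDyck
    rw [List.prefix_iff_eq_take.1 hq']
    exact h _

lemma isSchroder_iff (n : ℕ) (p : List SStep) :
    IsSchroder n p ↔ (eraseDiag p).count .U + p.count .D = n ∧
      (eraseDiag p).count .U = (eraseDiag p).count .D ∧
      ∀ i, ((eraseDiag p).take i).count .D ≤ ((eraseDiag p).take i).count .U := by
  rw [IsSchroder, pathY_le_pathX_of_prefix_iff, pathX_eq_count, pathY_eq_count]
  constructor
  · rintro ⟨h, h', h''⟩
    exact ⟨h, by omega, h''⟩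
  · rintro ⟨h, h', h''⟩
    exact ⟨h, by omega, h''⟩

lemma dFollowedByH_nil : DFollowedByH [] := by
  intro q r h
  simp at h

lemma dFollowedByH_cons (s : SStep) (p : List SStep) :
    DFollowedByH (s :: p) ↔
      (s = .D → p = [] ∨ ∃ r, p = .H :: r) ∧ DFollowedByH p := by
  constructor
  · intro h
    refine ⟨?_, fun q r e => h (s :: q) r (by simp [e])⟩
    rintro rfl
    exact h [] p rfl
  · rintro ⟨h, h'⟩ q r e
    cases q with
    | nil =>
      simp only [List.nil_append, List.cons.injEq] at e
      exact e.2 ▸ h e.1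
    | cons t q =>
      simp only [List.cons_append, List.cons.injEq] at e
      exact h' q r e.2

/-- The ways of inserting `d` diagonal steps in a Dyck path, each one right before a horizontal
step or at the end of the path. -/
def insertDiag : List DyckStep → ℕ → Finset (List SStep)
  | [], 0 => {[]}
  | [], 1 => {[.D]}
  | [], _ + 2 => ∅
  | .D :: w, d => (insertDiag w d).image (.V :: ·)
  | .U :: w, 0 => (insertDiag w 0).image (.H :: ·)
  | .U :: w, d + 1 =>
    (insertDiag w (d + 1)).image (.H :: ·) ∪ (insertDiag w d).image (.D :: .H :: ·)

lemma card_insertDiag (w : List DyckStep) (d : ℕ) :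
    (insertDiag w d).card = (w.count .U + 1).choose d := by
  induction w generalizing d with
  | nil =>
    match d with
    | 0 => rfl
    | 1 => rfl
    | d + 2 => simp [insertDiag, Nat.choose_eq_zero_of_lt]
  | cons s w ih =>
    cases s with
    | D =>
      rw [insertDiag, Finset.card_image_of_injective _ List.cons_injective, ih]
      simp
    | U =>
      cases d with
      | zero =>
        rw [insertDiag, Finset.card_image_of_injective _ List.cons_injective, ih]
        simp
      | succ d =>
        rw [insertDiag, Finset.card_union_of_disjoint,
          Finset.card_image_of_injective _ List.cons_injective,
          Finset.card_image_of_injective _ fun _ _ h => by simpa using h, ih, ih,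
          List.count_cons_self, Nat.choose_succ_succ (_ + 1) d, add_comm]
        simp [Finset.disjoint_left]

lemma eq_nil_or_of_eraseDiag_eq_nil {p : List SStep} (h : eraseDiag p = [])
    (hp : DFollowedByH p) : p = [] ∨ p = [.D] := by
  match p with
  | [] => simp
  | .H :: p => simp at h
  | .V :: p => simp at h
  | .D :: p =>
    obtain rfl | ⟨r, rfl⟩ := ((dFollowedByH_cons _ _).1 hp).1 rfl
    · simp
    · simp at h

lemma mem_insertDiag (w : List DyckStep) (d : ℕ) (p : List SStep) :
    p ∈ insertDiag w d ↔ eraseDiag p = w ∧ p.count .D = d ∧ DFollowedByH p := by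
  induction w generalizing d p with
  | nil =>
    constructor
    · match d with
      | 0 => simp +contextual [insertDiag, dFollowedByH_nil]
      | 1 => simp +contextual [insertDiag, dFollowedByH_nil, dFollowedByH_cons]
      | d + 2 => simp [insertDiag]
    · rintro ⟨h, rfl, hp⟩
      obtain rfl | rfl := eq_nil_or_of_eraseDiag_eq_nil h hp <;> simp [insertDiag]
  | cons s w ih =>
    constructor
    · cases s with
      | D =>
        simp only [insertDiag, Finset.mem_image, ih]
        rintro ⟨p, ⟨rfl, rfl, hp⟩, rfl⟩
        simp [dFollowedByH_cons, hp]
      | U =>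
        cases d with
        | zero =>
          simp only [insertDiag, Finset.mem_image, ih]
          rintro ⟨p, ⟨rfl, h, hp⟩, rfl⟩
          simp [dFollowedByH_cons, hp, h]
        | succ d =>
          simp only [insertDiag, Finset.mem_union, Finset.mem_image, ih]
          rintro (⟨p, ⟨rfl, h, hp⟩, rfl⟩ | ⟨p, ⟨rfl, h, hp⟩, rfl⟩) <;>
            simp [dFollowedByH_cons, hp, h]
    · rintro ⟨h, rfl, hp⟩
      match p with
      | [] => simp at h
      | .V :: p =>
        rw [eraseDiag_cons_V, List.cons.injEq] at h
        obtain ⟨rfl, rfl⟩ := h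
        simp [insertDiag, ih, ((dFollowedByH_cons _ _).1 hp).2]
      | .H :: p =>
        rw [eraseDiag_cons_H, List.cons.injEq] at h
        obtain ⟨rfl, rfl⟩ := h
        have hp' := ((dFollowedByH_cons _ _).1 hp).2
        cases e : p.count .D <;> simp [insertDiag, ih, hp', e]
      | .D :: p =>
        obtain ⟨hr, hp'⟩ := (dFollowedByH_cons _ _).1 hp
        obtain rfl | ⟨r, rfl⟩ := hr rfl
        · simp at h
        · rw [eraseDiag_cons_D, eraseDiag_cons_H, List.cons.injEq] at h
          obtain ⟨rfl, rfl⟩ := h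
          simp [insertDiag, ih, ((dFollowedByH_cons _ _).1 hp').2]

/-- A restricted Schröder path is a Dyck path together with an insertion of diagonal steps. -/
noncomputable def rpEquiv (m d : ℕ) :
    (Σ w : {w : DyckWord // w.semilength = m}, insertDiag w.1.toList d) ≃ RP (d + m) m :=
  Equiv.ofBijective
    (fun x => ⟨x.2.1, by
      obtain ⟨⟨w, rfl⟩, p, hp⟩ := x
      obtain ⟨h, rfl, h'⟩ := (mem_insertDiag _ _ _).1 hp
      refine ⟨(isSchroder_iff _ _).2 ?_, rfl, h'⟩
      rw [h]
      exact ⟨add_comm _ _, w.count_U_eq_count_D, w.count_D_le_count_U⟩⟩)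
    (by
      constructor
      · rintro ⟨⟨w, hw⟩, p, hp⟩ ⟨⟨w', hw'⟩, p', hp'⟩ e
        obtain rfl : p = p' := congrArg Subtype.val e
        obtain rfl : w = w' := DyckWord.ext
          (((mem_insertDiag _ _ _).1 hp).1.symm.trans ((mem_insertDiag _ _ _).1 hp').1)
        rfl
      · rintro ⟨p, hs, hc, hp⟩
        obtain ⟨h, h', h''⟩ := (isSchroder_iff _ _).1 hs
        exact ⟨⟨⟨⟨eraseDiag p, h', h''⟩, by simp only [DyckWord.semilength]; omega⟩, p,
          (mem_insertDiag _ _ _).2 ⟨rfl, by omega, hp⟩⟩, rfl⟩)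

lemma card_RP_add (m d : ℕ) :
    Nat.card (RP (d + m) m) = catalan m * (m + 1).choose d := by
  have hcard (w : {w : DyckWord // w.semilength = m}) :
      Nat.card (insertDiag w.1.toList d) = (m + 1).choose d := by
    rw [Nat.card_eq_fintype_card, Fintype.card_coe, card_insertDiag]
    exact congrArg (fun k => (k + 1).choose d) w.2
  rw [← Nat.card_congr (rpEquiv m d), Nat.card_sigma]
  simp only [hcard, Finset.sum_const, Finset.card_univ, smul_eq_mul,
    DyckWord.card_dyckWord_semilength_eq_catalan]

/-- |RP(n,m)| = C(m)·binom(m+1, n−m) (the binomial coefficient with a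
negative lower index being 0). -/
theorem statement3 (n m : ℕ) (hn : 1 ≤ n) :
    Nat.card (RP n m) = if m ≤ n then catalan m * (m + 1).choose (n - m) else 0 := by
  split_ifs with h
  · obtain ⟨d, rfl⟩ := Nat.exists_eq_add_of_le' h
    rw [card_RP_add, Nat.add_sub_cancel]
  · have : IsEmpty (RP n m) := ⟨fun p => by have := p.2.2.1; omega⟩
    exact Nat.card_of_isEmpty
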